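/- arXiv:1407.8084 — 5 statements merged into one kernel-verified Lean document; each statement's English description precedes it below -/
import Mathlib

section
/- Let ρ₀, H : ℝ → ℝ be differentiable with ρ₀(t) > 0 for all t, let Λ ∈ ℝ, and let φ : ℝ × ℝ³ → ℝ be such that φ(t,·) is twice continuously differentiable for each t. Suppose the Newtonian cosmological equations (Poisson, mass conservation, and Euler) all hold with the homogeneous–isotropic ansatz ρ(t,x) = ρ₀(t), v(t,x) = H(t)x. Then the first Friedmann (acceleration) equation holds: H'(t) + H(t)² = −(4π/3) ρ₀(t) + Λ/3 for all t. -/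
open Real

theorem fderiv_const_mul_apply {ι : Type*} [Fintype ι] (c : ℝ) (i : ι)
    (x v : ι → ℝ) : fderiv ℝ (fun y : ι → ℝ => c * y i) x v = c * v i := by
  have h := (hasFDerivAt_apply (𝕜 := ℝ) i x).const_mul c
  rw [h.fderiv]
  simp

theorem fderiv_const_mul_mul_apply {ι : Type*} [Fintype ι] (c : ℝ) (i j : ι)
    (x v : ι → ℝ) : fderiv ℝ (fun y : ι → ℝ => c * (y i * y j)) x v =
      c * (x i * v j + x j * v i) := by
  have h := ((hasFDerivAt_apply (𝕜 := ℝ) i x).mul (hasFDerivAt_apply (𝕜 := ℝ) j x)).const_mul c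
  have h' : HasFDerivAt (fun y : ι → ℝ => c * (y i * y j)) _ x := h
  rw [h'.fderiv]
  simp [mul_add]

theorem friedmann_acceleration_from_newtonian_equations
    (ρ₀ H : ℝ → ℝ) (Λ : ℝ) (φ : ℝ → (Fin 3 → ℝ) → ℝ)
    (hρdiff : Differentiable ℝ ρ₀) (hHdiff : Differentiable ℝ H)
    (hρpos : ∀ t, 0 < ρ₀ t)
    (hφ : ∀ t, ContDiff ℝ 2 (φ t))
    (poisson : ∀ (t : ℝ) (x : Fin 3 → ℝ),
      (∑ i : Fin 3,
          fderiv ℝ (fun y : Fin 3 → ℝ => fderiv ℝ (φ t) y (Pi.single i 1)) x (Pi.single i 1))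
        + Λ = 4 * π * ρ₀ t)
    (masscons : ∀ (t : ℝ) (x : Fin 3 → ℝ),
      deriv ρ₀ t
        + ∑ i : Fin 3,
            fderiv ℝ (fun y : Fin 3 → ℝ => ρ₀ t * (H t * y i)) x (Pi.single i 1) = 0)
    (euler : ∀ (t : ℝ) (x : Fin 3 → ℝ) (i : Fin 3),
      deriv (fun s => ρ₀ s * (H s * x i)) t
        + ∑ j : Fin 3,
            fderiv ℝ (fun y : Fin 3 → ℝ => ρ₀ t * (H t * y i) * (H t * y j)) x
              (Pi.single j 1)
        = - (ρ₀ t * fderiv ℝ (φ t) x (Pi.single i 1))) :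
    ∀ t : ℝ, deriv H t + (H t) ^ 2 = -(4 * π / 3) * ρ₀ t + Λ / 3 := by
  intro t
  have hρ : ρ₀ t ≠ 0 := (hρpos t).ne'
  have hmass : deriv ρ₀ t = -(3 * (ρ₀ t * H t)) := by
    have h := masscons t 0
    simp only [← mul_assoc, fderiv_const_mul_apply, Pi.single_eq_same,
      Finset.sum_const, Finset.card_univ, Fintype.card_fin, nsmul_eq_mul] at h
    push_cast at h
    linarith
  have hgrad : ∀ (x : Fin 3 → ℝ) (i : Fin 3),
      fderiv ℝ (φ t) x (Pi.single i 1) = -(deriv H t + H t ^ 2) * x i := by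
    intro x i
    have h := euler t x i
    have hderiv : deriv (fun s => ρ₀ s * (H s * x i)) t =
        deriv ρ₀ t * (H t * x i) + ρ₀ t * (deriv H t * x i) :=
      ((hρdiff t).hasDerivAt.mul ((hHdiff t).hasDerivAt.mul_const (x i))).deriv
    have hflux : ∑ j : Fin 3, fderiv ℝ
        (fun y : Fin 3 → ℝ => ρ₀ t * (H t * y i) * (H t * y j)) x (Pi.single j 1) =
        4 * (ρ₀ t * H t ^ 2 * x i) := by
      have hfun : ∀ j : Fin 3, (fun y : Fin 3 → ℝ => ρ₀ t * (H t * y i) * (H t * y j)) =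
          fun y => ρ₀ t * H t ^ 2 * (y i * y j) := fun j => by
        funext y
        ring
      simp only [hfun, fderiv_const_mul_mul_apply]
      fin_cases i <;> simp [Fin.sum_univ_three, Pi.single_apply] <;> ring
    rw [hderiv, hflux, hmass] at h
    apply mul_left_cancel₀ hρ
    linarith
  have h := poisson t 0
  simp only [hgrad, fderiv_const_mul_apply, Pi.single_eq_same,
    Finset.sum_const, Finset.card_univ, Fintype.card_fin, nsmul_eq_mul] at h
  push_cast at h
  linarith
end

section
/- Let ρ₀, H, a : ℝ → ℝ be differentiable with a(t) > 0 for all t, a'(t) = H(t) a(t), ρ₀'(t) = −3 H(t) ρ₀(t), and H'(t) + H(t)² = −(4π/3) ρ₀(t) + Λ/3. Then the function t ↦ a(t)² ( H(t)² − (8π/3) ρ₀(t) − Λ/3 ) is constant; consequently there exists a constant k such that the second Friedmann equation H(t)² = (8π/3) ρ₀(t) + Λ/3 − k/a(t)² holds for all t. -/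
open Real

/-!
STATEMENT 2: Given differentiable ρ₀, H, a : ℝ → ℝ with a > 0, a' = H a,
ρ₀' = −3Hρ₀, and the acceleration equation H' + H² = −(4π/3)ρ₀ + Λ/3,
the function t ↦ a(t)² (H(t)² − (8π/3)ρ₀(t) − Λ/3) is constant; hence
there exists k with H(t)² = (8π/3)ρ₀(t) + Λ/3 − k/a(t)² for all t
(the second Friedmann equation).
-/
theorem friedmann_second_equation_first_integral
    (ρ₀ H a : ℝ → ℝ) (Λ : ℝ)
    (hρ : Differentiable ℝ ρ₀) (hH : Differentiable ℝ H) (ha : Differentiable ℝ a)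
    (hapos : ∀ t, 0 < a t)
    (ha' : ∀ t, deriv a t = H t * a t)
    (hρ' : ∀ t, deriv ρ₀ t = -3 * H t * ρ₀ t)
    (hacc : ∀ t, deriv H t + (H t) ^ 2 = -(4 * π / 3) * ρ₀ t + Λ / 3) :
    (∀ s t : ℝ,
        a s ^ 2 * ((H s) ^ 2 - (8 * π / 3) * ρ₀ s - Λ / 3)
          = a t ^ 2 * ((H t) ^ 2 - (8 * π / 3) * ρ₀ t - Λ / 3))
    ∧ ∃ k : ℝ, ∀ t : ℝ,
        (H t) ^ 2 = (8 * π / 3) * ρ₀ t + Λ / 3 - k / a t ^ 2 := by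
  have hconst : ∀ s t : ℝ,
      a s ^ 2 * ((H s) ^ 2 - (8 * π / 3) * ρ₀ s - Λ / 3)
        = a t ^ 2 * ((H t) ^ 2 - (8 * π / 3) * ρ₀ t - Λ / 3) := by
    have hderiv : ∀ t, HasDerivAt
        (fun t => a t ^ 2 * ((H t) ^ 2 - (8 * π / 3) * ρ₀ t - Λ / 3)) 0 t := by
      intro t
      have h := ((ha t).hasDerivAt.fun_pow 2).fun_mul
        ((((hH t).hasDerivAt.fun_pow 2).fun_sub
          ((hρ t).hasDerivAt.const_mul (8 * π / 3))).sub_const (Λ / 3))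
      refine h.congr_deriv ?_
      rw [ha', hρ', eq_sub_of_add_eq (hacc t)]
      push_cast
      ring
    exact is_const_of_deriv_eq_zero (fun t => (hderiv t).differentiableAt)
      (fun t => (hderiv t).deriv)
  refine ⟨hconst, -(a 0 ^ 2 * ((H 0) ^ 2 - (8 * π / 3) * ρ₀ 0 - Λ / 3)), fun t => ?_⟩
  have hat : a t ≠ 0 := (hapos t).ne'
  rw [hconst 0 t]
  field_simp
  ring
end

section
/- In the Buchert averaging setup, suppose the pointwise Hamiltonian constraint for irrotational dust holds: (1/3) θ(t,x)² + (1/2) R(t,x) − σ²(t,x) = 8π ρ(t,x) for all (t,x), where R is the spatial scalar curvature, σ² the shear scalar, and ρ the dust density. Then the averaged Friedmann-type equation holds: 3 (a_D'(t)/a_D(t))² = 8π ⟨ρ⟩(t) − (1/2) ⟨R⟩(t) − (1/2) 𝒬_D(t), where 𝒬_D(t) = (2/3)(⟨θ²⟩(t) − ⟨θ⟩(t)²) − 2⟨σ²⟩(t) is the kinematical backreaction. -/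
open MeasureTheory Real

/-- Buchert volume: `V(t) = ∫_D w(t,·) dμ`, where `w` is the Riemannian
volume element of the synchronous comoving slicing. -/
noncomputable def buchertVol {D : Type*} [MeasurableSpace D] (μ : Measure D)
    (w : ℝ → D → ℝ) : ℝ → ℝ :=
  fun t => ∫ x, w t x ∂μ

/-- Buchert effective scale factor: `a_D(t) = V(t)^(1/3)`. -/
noncomputable def buchertScale {D : Type*} [MeasurableSpace D] (μ : Measure D)
    (w : ℝ → D → ℝ) : ℝ → ℝ :=
  fun t => buchertVol μ w t ^ (1 / 3 : ℝ)

/-- Buchert spatial average: `⟨ψ⟩(t) = V(t)⁻¹ ∫_D ψ(t,·) w(t,·) dμ`. -/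
noncomputable def buchertAvg {D : Type*} [MeasurableSpace D] (μ : Measure D)
    (w ψ : ℝ → D → ℝ) : ℝ → ℝ :=
  fun t => (buchertVol μ w t)⁻¹ * ∫ x, ψ t x * w t x ∂μ

/-- Kinematical backreaction:
`𝒬_D(t) = (2/3)(⟨θ²⟩ − ⟨θ⟩²) − 2⟨σ²⟩`. -/
noncomputable def buchertQ {D : Type*} [MeasurableSpace D] (μ : Measure D)
    (w θ σ2 : ℝ → D → ℝ) : ℝ → ℝ :=
  fun t => (2 / 3) * (buchertAvg μ w (fun s x => θ s x ^ 2) t - (buchertAvg μ w θ t) ^ 2)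
    - 2 * buchertAvg μ w σ2 t

theorem buchertVol_pos {D : Type*} [MeasurableSpace D] {μ : Measure D} {w : ℝ → D → ℝ} {t : ℝ}
    (hμ : 0 < μ Set.univ) (hw : ∀ x, 0 < w t x) (hint : Integrable (w t) μ) :
    0 < buchertVol μ w t := by
  have hsupp : Function.support (w t) = Set.univ :=
    Set.eq_univ_of_forall fun x => (hw x).ne'
  exact (integral_pos_iff_support_of_nonneg (fun x => (hw x).le) hint).2 (hsupp ▸ hμ)

/-- The effective Hubble rate is a third of the averaged expansion. -/
theorem deriv_buchertScale_div {D : Type*} [MeasurableSpace D] {μ : Measure D}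
    {w θ : ℝ → D → ℝ} {t : ℝ} (hpos : 0 < buchertVol μ w t)
    (hV : HasDerivAt (buchertVol μ w) (∫ x, θ t x * w t x ∂μ) t) :
    deriv (buchertScale μ w) t / buchertScale μ w t = buchertAvg μ w θ t / 3 := by
  have h : HasDerivAt (buchertScale μ w) _ t := hV.rpow_const (p := 1 / 3) (Or.inl hpos.ne')
  have hs : buchertVol μ w t ^ (1 / 3 : ℝ) ≠ 0 := (rpow_pos_of_pos hpos _).ne'
  rw [h.deriv, buchertScale, buchertAvg, rpow_sub_one hpos.ne']
  field_simp

/-- The average of the Hamiltonian constraint. -/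
theorem buchertAvg_hamiltonian {D : Type*} [MeasurableSpace D] {μ : Measure D}
    {w θ σ2 ρ R : ℝ → D → ℝ} {t : ℝ}
    (hθ2 : Integrable (fun x => θ t x ^ 2 * w t x) μ)
    (hσ2 : Integrable (fun x => σ2 t x * w t x) μ)
    (hR : Integrable (fun x => R t x * w t x) μ)
    (hamiltonian : ∀ x,
      (1 / 3) * θ t x ^ 2 + (1 / 2) * R t x - σ2 t x = 8 * π * ρ t x) :
    (1 / 3) * buchertAvg μ w (fun s x => θ s x ^ 2) t + (1 / 2) * buchertAvg μ w R t
      - buchertAvg μ w σ2 t = 8 * π * buchertAvg μ w ρ t := by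
  have h : (1 / 3) * (∫ x, θ t x ^ 2 * w t x ∂μ) + (1 / 2) * (∫ x, R t x * w t x ∂μ)
      - (∫ x, σ2 t x * w t x ∂μ) = 8 * π * ∫ x, ρ t x * w t x ∂μ := by
    simp only [← integral_const_mul]
    rw [← integral_add (hθ2.const_mul _) (hR.const_mul _),
      ← integral_sub ((hθ2.const_mul _).fun_add (hR.const_mul _)) hσ2]
    refine integral_congr_ae (.of_forall fun x => ?_)
    linear_combination w t x * hamiltonian x
  simp only [buchertAvg]
  linear_combination (buchertVol μ w t)⁻¹ * h

/-!
STATEMENT 9: In the Buchert averaging setup, if the pointwise Hamiltonian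
constraint for irrotational dust holds,
(1/3)θ² + (1/2)R − σ² = 8πρ, then the averaged Friedmann-type equation
holds: 3 (a_D'(t)/a_D(t))² = 8π⟨ρ⟩(t) − (1/2)⟨R⟩(t) − (1/2)𝒬_D(t).
Differentiation under the integral sign is encoded by `hV`.
-/
theorem buchert_averaged_friedmann_equation
    {D : Type*} [MeasurableSpace D] (μ : Measure D)
    (hDpos : 0 < μ Set.univ) (hDfin : μ Set.univ < ⊤)
    (w θ σ2 ρ R : ℝ → D → ℝ)
    (hw : ∀ t x, 0 < w t x)
    (hwint : ∀ t, Integrable (w t) μ)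
    (hθwint : ∀ t, Integrable (fun x => θ t x * w t x) μ)
    (hθ2wint : ∀ t, Integrable (fun x => θ t x ^ 2 * w t x) μ)
    (hσ2wint : ∀ t, Integrable (fun x => σ2 t x * w t x) μ)
    (hρwint : ∀ t, Integrable (fun x => ρ t x * w t x) μ)
    (hRwint : ∀ t, Integrable (fun x => R t x * w t x) μ)
    (hdw : ∀ x, ∀ t, HasDerivAt (fun s => w s x) (θ t x * w t x) t)
    (hamiltonian : ∀ t x,
      (1 / 3) * θ t x ^ 2 + (1 / 2) * R t x - σ2 t x = 8 * π * ρ t x)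
    (hV : ∀ t, HasDerivAt (buchertVol μ w) (∫ x, θ t x * w t x ∂μ) t) :
    ∀ t : ℝ,
      3 * (deriv (buchertScale μ w) t / buchertScale μ w t) ^ 2
        = 8 * π * buchertAvg μ w ρ t - (1 / 2) * buchertAvg μ w R t
          - (1 / 2) * buchertQ μ w θ σ2 t := by
  intro t
  rw [deriv_buchertScale_div (buchertVol_pos hDpos (hw t) (hwint t)) (hV t), buchertQ]
  linear_combination
    buchertAvg_hamiltonian (hθ2wint t) (hσ2wint t) (hRwint t) (hamiltonian t)
end

section
/- Let γ : (0,1] × ℝⁿ → ℝ be such that γ(λ,·) is twice continuously differentiable for each λ, and suppose there is a continuous positive function C₁ on ℝⁿ with |γ(λ,x)| ≤ λ C₁(x) for all λ ∈ (0,1] and x ∈ ℝⁿ. Then for all indices i, j, the second partial derivatives converge weakly to zero: wlim_{λ→0} ∂_i ∂_j γ(λ) = 0, i.e., for every smooth compactly supported f : ℝⁿ → ℝ, ∫ f ∂_i∂_j γ(λ,·) → 0 as λ → 0⁺. -/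
open MeasureTheory Filter Set

/-- Integration by parts against a compactly supported `C¹` function. -/
theorem integral_mul_fderiv_eq_neg_of_hasCompactSupport
    {E : Type*} [NormedAddCommGroup E] [NormedSpace ℝ E] [FiniteDimensional ℝ E]
    [MeasurableSpace E] [BorelSpace E] {μ : Measure E} [μ.IsAddHaarMeasure]
    {f g : E → ℝ} (hf : ContDiff ℝ 1 f) (hfc : HasCompactSupport f) (hg : ContDiff ℝ 1 g)
    (v : E) :
    ∫ x, f x * fderiv ℝ g x v ∂μ = -∫ x, fderiv ℝ f x v * g x ∂μ := by
  have hf' : Continuous fun x => fderiv ℝ f x v :=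
    (hf.continuous_fderiv one_ne_zero).clm_apply continuous_const
  have hg' : Continuous fun x => fderiv ℝ g x v :=
    (hg.continuous_fderiv one_ne_zero).clm_apply continuous_const
  apply integral_mul_fderiv_eq_neg_fderiv_mul_of_integrable
  · exact (hf'.mul hg.continuous).integrable_of_hasCompactSupport
      (hfc.fderiv_apply ℝ v).mul_right
  · exact (hf.continuous.mul hg').integrable_of_hasCompactSupport hfc.mul_right
  · exact (hf.continuous.mul hg.continuous).integrable_of_hasCompactSupport hfc.mul_right
  · exact fun x _ => hf.differentiable one_ne_zero x
  · exact fun x _ => hg.differentiable one_ne_zero x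

/-- A family of functions that is `O(l)` locally uniformly as `l → 0⁺` integrates to something
that tends to `0` against any compactly supported continuous function. -/
theorem tendsto_integral_mul_of_abs_le_mul
    {E : Type*} [TopologicalSpace E] [MeasurableSpace E] [OpensMeasurableSpace E]
    {μ : Measure E} [IsFiniteMeasureOnCompacts μ]
    {γ : ℝ → E → ℝ} {C f : E → ℝ} (hC : Continuous C)
    (hbound : ∀ l ∈ Ioc (0 : ℝ) 1, ∀ x, |γ l x| ≤ l * C x)
    (hf : Continuous f) (hfc : HasCompactSupport f) :
    Tendsto (fun l => ∫ x, f x * γ l x ∂μ) (nhdsWithin 0 (Ioi 0)) (nhds 0) := by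
  have hint : Integrable (fun x => |f x| * C x) μ :=
    (hf.abs.mul hC).integrable_of_hasCompactSupport hfc.norm.mul_right
  have hlim : Tendsto (fun l : ℝ => l * ∫ x, |f x| * C x ∂μ) (nhdsWithin 0 (Ioi 0)) (nhds 0) := by
    have h : Continuous fun l : ℝ => l * ∫ x, |f x| * C x ∂μ := by fun_prop
    simpa using (h.tendsto 0).mono_left nhdsWithin_le_nhds
  refine squeeze_zero_norm' ?_ hlim
  filter_upwards [Ioc_mem_nhdsGT (zero_lt_one' ℝ)] with l hl
  rw [← integral_const_mul]
  refine norm_integral_le_of_norm_le (hint.const_mul l) (Eventually.of_forall fun x => ?_)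
  rw [Real.norm_eq_abs, abs_mul, mul_left_comm]
  exact mul_le_mul_of_nonneg_left (hbound l hl x) (abs_nonneg _)

/-!
STATEMENT 13: (Green–Wald condition (ii) kills the linear second-derivative
terms in the weak limit.) Let γ : (0,1] × ℝⁿ → ℝ with γ(λ,·) twice
continuously differentiable, and suppose |γ(λ,x)| ≤ λ C₁(x) for a continuous
positive C₁. Then for all indices i, j, the second partial derivatives
∂_i ∂_j γ(λ) converge weakly to 0 as λ → 0⁺: for every smooth compactly
supported f, ∫ f ∂_i∂_j γ(λ,·) → 0 as λ → 0⁺.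
Partial derivatives are coded as `fderiv` in the coordinate directions
`EuclideanSpace.single _ 1`, and integrals are with respect to the Lebesgue
measure (volume) on ℝⁿ = EuclideanSpace ℝ (Fin n).
-/
theorem second_derivatives_weakly_vanish
    (n : ℕ) (γ : ℝ → EuclideanSpace ℝ (Fin n) → ℝ)
    (hγ : ∀ l ∈ Ioc (0 : ℝ) 1, ContDiff ℝ 2 (γ l))
    (C₁ : EuclideanSpace ℝ (Fin n) → ℝ)
    (hC₁cont : Continuous C₁) (hC₁pos : ∀ x, 0 < C₁ x)
    (hbound : ∀ l ∈ Ioc (0 : ℝ) 1, ∀ x, |γ l x| ≤ l * C₁ x) :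
    ∀ (i j : Fin n) (f : EuclideanSpace ℝ (Fin n) → ℝ),
      ContDiff ℝ (⊤ : ℕ∞) f → HasCompactSupport f →
      Tendsto
        (fun l => ∫ x, f x *
          fderiv ℝ (fun y => fderiv ℝ (γ l) y (EuclideanSpace.single j 1)) x
            (EuclideanSpace.single i 1))
        (nhdsWithin 0 (Ioi 0)) (nhds 0) := by
  intro i j f hf hfc
  set u : EuclideanSpace ℝ (Fin n) := EuclideanSpace.single i 1
  set v : EuclideanSpace ℝ (Fin n) := EuclideanSpace.single j 1
  have hf₁ : ContDiff ℝ 1 fun x => fderiv ℝ f x u :=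
    (hf.fderiv_right (m := 1) (by norm_cast)).clm_apply contDiff_const
  have hf₁c : HasCompactSupport fun x => fderiv ℝ f x u := hfc.fderiv_apply ℝ u
  have hf₂ : Continuous fun x => fderiv ℝ (fun y => fderiv ℝ f y u) x v :=
    (hf₁.continuous_fderiv one_ne_zero).clm_apply continuous_const
  refine (tendsto_integral_mul_of_abs_le_mul (μ := volume) hC₁cont hbound hf₂
    (hf₁c.fderiv_apply ℝ v)).congr' ?_
  filter_upwards [Ioc_mem_nhdsGT (zero_lt_one' ℝ)] with l hl
  have hγ₁ : ContDiff ℝ 1 fun y => fderiv ℝ (γ l) y v :=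
    ((hγ l hl).fderiv_right (m := 1) (by norm_num)).clm_apply contDiff_const
  rw [integral_mul_fderiv_eq_neg_of_hasCompactSupport (hf.of_le (by norm_cast)) hfc hγ₁,
    integral_mul_fderiv_eq_neg_of_hasCompactSupport hf₁ hf₁c ((hγ l hl).of_le (by norm_num)),
    neg_neg]
end

section
/- Let γ : (0,1] × ℝⁿ → ℝ be such that γ(λ,·) is twice continuously differentiable for each λ. Suppose: (ii) there is a continuous positive C₁ on ℝⁿ with |γ(λ,x)| ≤ λ C₁(x); (iii) there is a continuous positive C₂ on ℝⁿ with |∂_k γ(λ,x)| ≤ C₂(x) for all k; and (iv) for fixed indices i, j there is a locally integrable μ_ij on ℝⁿ with wlim_{λ→0} [∂_i γ(λ) · ∂_j γ(λ)] = μ_ij. Then wlim_{λ→0} [γ(λ) · ∂_i ∂_j γ(λ)] = −μ_ij. -/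
open MeasureTheory Filter Set

theorem integral_mul_mul_fderiv_fderiv_of_hasCompactSupport
    {E : Type*} [NormedAddCommGroup E] [NormedSpace ℝ E] [FiniteDimensional ℝ E]
    [MeasurableSpace E] [BorelSpace E] {μ : Measure E} [μ.IsAddHaarMeasure]
    {f u : E → ℝ} (hf : ContDiff ℝ 1 f) (hfc : HasCompactSupport f) (hu : ContDiff ℝ 2 u)
    (v w : E) :
    ∫ x, f x * (u x * fderiv ℝ (fun y => fderiv ℝ u y w) x v) ∂μ =
      -(∫ x, fderiv ℝ f x v * (u x * fderiv ℝ u x w) ∂μ) -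
        ∫ x, f x * (fderiv ℝ u x v * fderiv ℝ u x w) ∂μ := by
  have hu1 : ContDiff ℝ 1 u := hu.of_le (by norm_num)
  have hw : ContDiff ℝ 1 (fun y => fderiv ℝ u y w) :=
    (hu.fderiv_right (m := 1) (by norm_num)).clm_apply contDiff_const
  have hfu : ContDiff ℝ 1 (fun x => f x * u x) := hf.mul hu1
  have cf := hf.continuous
  have cu := hu1.continuous
  have cw := hw.continuous
  have cf' : Continuous (fun x => fderiv ℝ f x v) :=
    (hf.continuous_fderiv one_ne_zero).clm_apply continuous_const
  have cu' : Continuous (fun x => fderiv ℝ u x v) :=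
    (hu1.continuous_fderiv one_ne_zero).clm_apply continuous_const
  have cw' : Continuous (fun x => fderiv ℝ (fun y => fderiv ℝ u y w) x v) :=
    (hw.continuous_fderiv one_ne_zero).clm_apply continuous_const
  have hf'c : HasCompactSupport (fun x => fderiv ℝ f x v) := hfc.fderiv_apply ℝ v
  have int₁ : Integrable (fun x => fderiv ℝ f x v * (u x * fderiv ℝ u x w)) μ :=
    (cf'.mul (cu.mul cw)).integrable_of_hasCompactSupport hf'c.mul_right
  have int₂ : Integrable (fun x => f x * (fderiv ℝ u x v * fderiv ℝ u x w)) μ :=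
    (cf.mul (cu'.mul cw)).integrable_of_hasCompactSupport hfc.mul_right
  have hprod : (fun x => fderiv ℝ (fun y => f y * u y) x v * fderiv ℝ u x w) =
      fun x => fderiv ℝ f x v * (u x * fderiv ℝ u x w) +
        f x * (fderiv ℝ u x v * fderiv ℝ u x w) := by
    ext x
    rw [fderiv_fun_mul (hf.differentiable one_ne_zero x) (hu1.differentiable one_ne_zero x)]
    simp only [add_apply, smul_apply, smul_eq_mul]
    ring
  have key := integral_mul_fderiv_eq_neg_fderiv_mul_of_integrable (μ := μ) (v := v)
    (f := fun x => f x * u x) (g := fun x => fderiv ℝ u x w)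
    (by rw [hprod]; exact int₁.add int₂)
    (((cf.mul cu).mul cw').integrable_of_hasCompactSupport hfc.mul_right.mul_right)
    (((cf.mul cu).mul cw).integrable_of_hasCompactSupport hfc.mul_right.mul_right)
    (fun x _ => hfu.differentiable one_ne_zero x)
    (fun x _ => hw.differentiable one_ne_zero x)
  rw [hprod, integral_add int₁ int₂] at key
  simp only [← mul_assoc] at key ⊢
  rw [key]
  ring

/-!
STATEMENT 15: (Green–Wald integration-by-parts identity.) Let
γ : (0,1] × ℝⁿ → ℝ with γ(λ,·) twice continuously differentiable, satisfying
(ii) |γ(λ,x)| ≤ λ C₁(x) with C₁ continuous and positive;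
(iii) |∂_k γ(λ,x)| ≤ C₂(x) for all k, with C₂ continuous and positive;
(iv) for fixed indices i, j, wlim_{λ→0} [∂_i γ(λ) · ∂_j γ(λ)] = μ_ij for a
locally integrable μ_ij.
Then wlim_{λ→0} [γ(λ) · ∂_i ∂_j γ(λ)] = −μ_ij; i.e. for every smooth
compactly supported f, ∫ f γ(λ) ∂_i∂_j γ(λ) → ∫ f (−μ_ij) as λ → 0⁺.
Partial derivatives are coded as `fderiv` in the coordinate directions
`EuclideanSpace.single _ 1`, and integrals are with respect to the Lebesgue
measure (volume) on ℝⁿ = EuclideanSpace ℝ (Fin n).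
-/
theorem green_wald_integration_by_parts
    (n : ℕ) (i j : Fin n) (γ : ℝ → EuclideanSpace ℝ (Fin n) → ℝ)
    (hγ : ∀ l ∈ Ioc (0 : ℝ) 1, ContDiff ℝ 2 (γ l))
    (C₁ C₂ : EuclideanSpace ℝ (Fin n) → ℝ)
    (hC₁cont : Continuous C₁) (hC₁pos : ∀ x, 0 < C₁ x)
    (hC₂cont : Continuous C₂) (hC₂pos : ∀ x, 0 < C₂ x)
    (hbound₁ : ∀ l ∈ Ioc (0 : ℝ) 1, ∀ x, |γ l x| ≤ l * C₁ x)
    (hbound₂ : ∀ l ∈ Ioc (0 : ℝ) 1, ∀ x, ∀ k : Fin n,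
      |fderiv ℝ (γ l) x (EuclideanSpace.single k 1)| ≤ C₂ x)
    (μij : EuclideanSpace ℝ (Fin n) → ℝ)
    (hμij : LocallyIntegrable μij)
    (hwlim : ∀ f : EuclideanSpace ℝ (Fin n) → ℝ,
      ContDiff ℝ (⊤ : ℕ∞) f → HasCompactSupport f →
      Tendsto
        (fun l => ∫ x, f x *
          (fderiv ℝ (γ l) x (EuclideanSpace.single i 1) *
            fderiv ℝ (γ l) x (EuclideanSpace.single j 1)))
        (nhdsWithin 0 (Ioi 0)) (nhds (∫ x, f x * μij x))) :
    ∀ f : EuclideanSpace ℝ (Fin n) → ℝ,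
      ContDiff ℝ (⊤ : ℕ∞) f → HasCompactSupport f →
      Tendsto
        (fun l => ∫ x, f x *
          (γ l x *
            fderiv ℝ (fun y => fderiv ℝ (γ l) y (EuclideanSpace.single j 1)) x
              (EuclideanSpace.single i 1)))
        (nhdsWithin 0 (Ioi 0)) (nhds (∫ x, f x * (-μij x))) := by
  intro f hf hfc
  have hf1 : ContDiff ℝ 1 f := hf.of_le (by exact_mod_cast le_top)
  set ei : EuclideanSpace ℝ (Fin n) := EuclideanSpace.single i 1
  set ej : EuclideanSpace ℝ (Fin n) := EuclideanSpace.single j 1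
  have hI : ∀ᶠ l in nhdsWithin (0 : ℝ) (Ioi 0), l ∈ Ioc (0 : ℝ) 1 :=
    Ioc_mem_nhdsGT one_pos
  have cf' : Continuous (fun x => fderiv ℝ f x ei) :=
    (hf1.continuous_fderiv one_ne_zero).clm_apply continuous_const
  have hf'c : HasCompactSupport (fun x => fderiv ℝ f x ei) := hfc.fderiv_apply ℝ ei
  have hint : Integrable (fun x => |fderiv ℝ f x ei| * (C₁ x * C₂ x)) :=
    (cf'.abs.mul (hC₁cont.mul hC₂cont)).integrable_of_hasCompactSupport
      (hf'c.abs.mul_right)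
  have hzero : Tendsto
      (fun l => ∫ x, fderiv ℝ f x ei * (γ l x * fderiv ℝ (γ l) x ej))
      (nhdsWithin 0 (Ioi 0)) (nhds 0) := by
    have hlin : Tendsto (fun l : ℝ => l * ∫ x, |fderiv ℝ f x ei| * (C₁ x * C₂ x))
        (nhdsWithin 0 (Ioi 0)) (nhds 0) := by
      have h : Continuous (fun l : ℝ => l * ∫ x, |fderiv ℝ f x ei| * (C₁ x * C₂ x)) := by
        fun_prop
      simpa using (h.tendsto 0).mono_left nhdsWithin_le_nhds
    refine squeeze_zero_norm' ?_ hlin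
    filter_upwards [hI] with l hl
    rw [← integral_const_mul]
    refine norm_integral_le_of_norm_le (hint.const_mul l) (Eventually.of_forall fun x => ?_)
    rw [Real.norm_eq_abs, abs_mul, abs_mul]
    calc |fderiv ℝ f x ei| * (|γ l x| * |fderiv ℝ (γ l) x ej|)
        ≤ |fderiv ℝ f x ei| * (l * C₁ x * C₂ x) := by
          gcongr
          · exact mul_nonneg hl.1.le (hC₁pos x).le
          · exact hbound₁ l hl x
          · exact hbound₂ l hl x j
      _ = l * (|fderiv ℝ f x ei| * (C₁ x * C₂ x)) := by ring
  have hlim := hzero.neg.sub (hwlim f hf hfc)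
  have hμ : ∫ x, f x * (-μij x) = -0 - ∫ x, f x * μij x := by
    simp [integral_neg]
  rw [hμ]
  refine hlim.congr' ?_
  filter_upwards [hI] with l hl
  exact (integral_mul_mul_fderiv_fderiv_of_hasCompactSupport hf1 hfc (hγ l hl) ei ej).symm
end
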